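/- arXiv:2501.10873 — 5 statements merged into one kernel-verified Lean document; each statement's English description precedes it below -/
import Mathlib

section
/- Let w ∈ ℂ[z,y] with w not identically zero and set q = p + s·w. Then deg p ≤ d·deg q − d·k + d. -/
open MvPolynomial

theorem optionEquivLeft_symm_C_eq_rename {R σ : Type*} [CommRing R] (a : MvPolynomial σ R) :
    (optionEquivLeft R σ).symm (Polynomial.C a) = rename some a := by
  simp [optionEquivLeft]

theorem natDegree_le_totalDegree_optionEquivLeft_symm {R σ : Type*} [CommRing R]
    (F : Polynomial (MvPolynomial σ R)) :
    F.natDegree ≤ ((optionEquivLeft R σ).symm F).totalDegree := by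
  have h := natDegree_optionEquivLeft R ((optionEquivLeft R σ).symm F)
  rw [AlgEquiv.apply_symm_apply] at h
  exact h.trans_le (degreeOf_le_totalDegree _ _)

/-- Removing the top coefficient of the cofactor `W` raises the total degree of `P + S * W` by at
most `deg S - S.natDegree`; iterating bounds the total degree of the remainder `P`. -/
theorem totalDegree_optionEquivLeft_symm_le_add_mul {R σ : Type*} [CommRing R]
    {S P : Polynomial (MvPolynomial σ R)} (hS : S.Monic) (hP : P.degree < S.natDegree)
    (M : ℕ) (W : Polynomial (MvPolynomial σ R)) (hW : W.degree < M) :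
    ((optionEquivLeft R σ).symm P).totalDegree ≤
      ((optionEquivLeft R σ).symm (P + S * W)).totalDegree +
        (((optionEquivLeft R σ).symm S).totalDegree - S.natDegree) * M := by
  have hdeg := natDegree_le_totalDegree_optionEquivLeft_symm S
  induction M generalizing W with
  | zero =>
    have : W = 0 := by simpa [Nat.cast_withBot] using hW
    simp [this]
  | succ M ih =>
    set a := W.coeff M with ha
    have hcoeffW := Polynomial.degree_lt_iff_coeff_zero _ _ |>.1 hW
    have hWM : W.natDegree ≤ M := Polynomial.natDegree_le_iff_coeff_eq_zero.2 hcoeffW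
    have hW' : (W - Polynomial.C a * Polynomial.X ^ M).degree < (M : WithBot ℕ) := by
      rw [Polynomial.degree_lt_iff_coeff_zero]
      intro m hm
      rcases hm.eq_or_lt with rfl | hm
      · simp [ha]
      · simp [Polynomial.coeff_X_pow, hm.ne', hcoeffW m hm]
    have key := ih _ hW'
    by_cases h0 : a = 0
    · simp only [h0, map_zero, zero_mul, sub_zero] at key
      exact key.trans (by gcongr; omega)
    have hcoeff : (P + S * W).coeff (S.natDegree + M) = a := by
      rw [Polynomial.coeff_add, Polynomial.coeff_eq_zero_of_degree_lt
        (hP.trans_le (by exact_mod_cast Nat.le_add_right _ _)), zero_add,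
        Polynomial.coeff_mul_add_eq_of_natDegree_le le_rfl hWM, hS.coeff_natDegree, one_mul]
    have htop := totalDegree_coeff_optionEquivLeft_add_le R σ
      ((optionEquivLeft R σ).symm (P + S * W)) (S.natDegree + M)
      ((Polynomial.le_natDegree_of_ne_zero (by rwa [hcoeff])).trans
        (natDegree_le_totalDegree_optionEquivLeft_symm _))
    rw [AlgEquiv.apply_symm_apply, hcoeff] at htop
    have hsplit : P + S * (W - Polynomial.C a * Polynomial.X ^ M) =
        (P + S * W) - S * (Polynomial.C a * Polynomial.X ^ M) := by ring
    have hmono : ((optionEquivLeft R σ).symm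
        (Polynomial.C a * Polynomial.X ^ M)).totalDegree ≤ a.totalDegree + M := by
      rw [map_mul, map_pow, optionEquivLeft_symm_C_eq_rename, optionEquivLeft_symm_X]
      refine (totalDegree_mul _ _).trans (add_le_add (totalDegree_rename_le _ _) ?_)
      rw [X_pow_eq_monomial]
      exact (totalDegree_monomial_le _ _).trans (by simp)
    have hprod := totalDegree_mul ((optionEquivLeft R σ).symm S)
      ((optionEquivLeft R σ).symm (Polynomial.C a * Polynomial.X ^ M))
    rw [hsplit, map_sub, map_mul _ S] at key
    have hsub := totalDegree_sub ((optionEquivLeft R σ).symm (P + S * W))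
      ((optionEquivLeft R σ).symm S *
        (optionEquivLeft R σ).symm (Polynomial.C a * Polynomial.X ^ M))
    rw [mul_add, mul_one]
    omega

/-- For a nonzero cofactor `W`, both degree estimates are in terms of the degree of `P + S * W`. -/
theorem totalDegree_optionEquivLeft_symm_remainder_le {R σ : Type*} [CommRing R]
    {S P W : Polynomial (MvPolynomial σ R)} (hS : S.Monic) (hP : P.degree < S.natDegree)
    (hW : W ≠ 0) :
    S.natDegree ≤ ((optionEquivLeft R σ).symm (P + S * W)).totalDegree ∧
    ((optionEquivLeft R σ).symm P).totalDegree ≤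
      ((optionEquivLeft R σ).symm (P + S * W)).totalDegree +
        (((optionEquivLeft R σ).symm S).totalDegree - S.natDegree) *
          (((optionEquivLeft R σ).symm (P + S * W)).totalDegree - S.natDegree + 1) := by
  have hcoeff : (P + S * W).coeff (S.natDegree + W.natDegree) = W.leadingCoeff := by
    rw [Polynomial.coeff_add, Polynomial.coeff_eq_zero_of_degree_lt
      (hP.trans_le (by exact_mod_cast Nat.le_add_right _ _)), zero_add,
      Polynomial.coeff_mul_degree_add_degree, hS.leadingCoeff, one_mul]
  have hQ : S.natDegree + W.natDegree ≤
      ((optionEquivLeft R σ).symm (P + S * W)).totalDegree :=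
    (Polynomial.le_natDegree_of_ne_zero
      (by rwa [hcoeff, Polynomial.leadingCoeff_ne_zero])).trans
      (natDegree_le_totalDegree_optionEquivLeft_symm _)
  refine ⟨by omega, totalDegree_optionEquivLeft_symm_le_add_mul hS hP _ W ?_⟩
  refine Polynomial.degree_le_natDegree.trans_lt ?_
  exact_mod_cast (by omega : W.natDegree < _ - S.natDegree + 1)

theorem degree_sum_C_mul_X_pow_lt {R : Type*} [Semiring R] {k : ℕ} (c : Fin k → R) :
    (∑ j : Fin k, Polynomial.C (c j) * Polynomial.X ^ (j : ℕ)).degree < (k : WithBot ℕ) := by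
  refine (Polynomial.degree_sum_le _ _).trans_lt
    ((Finset.sup_lt_iff (WithBot.bot_lt_coe k)).2 fun j _ => ?_)
  exact (Polynomial.degree_C_mul_X_pow_le _ _).trans_lt (WithBot.coe_lt_coe.2 j.2)


/-- With `s(z,y) = y^k + ∑_{j<k} ς_j(z) y^j` of total degree `d ≥ k`,
`p(z,y) = ∑_{j<k} p_j(z) y^j`, `w ≢ 0` and `q = p + s·w`, one has
`deg p ≤ d·deg q − d·k + d` (as integers). -/
theorem stmt0 (N : ℕ) (hN : 1 ≤ N) (k : ℕ) (hk : 1 ≤ k)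
    (ς : Fin k → MvPolynomial (Fin N) ℂ)
    (s : MvPolynomial (Fin N ⊕ Unit) ℂ)
    (hs : s = X (Sum.inr ()) ^ k +
      ∑ j : Fin k, rename Sum.inl (ς j) * X (Sum.inr ()) ^ (j : ℕ))
    (d : ℕ) (hd : d = s.totalDegree) (hdk : k ≤ d)
    (pc : Fin k → MvPolynomial (Fin N) ℂ)
    (p : MvPolynomial (Fin N ⊕ Unit) ℂ)
    (hp : p = ∑ j : Fin k, rename Sum.inl (pc j) * X (Sum.inr ()) ^ (j : ℕ))
    (w : MvPolynomial (Fin N ⊕ Unit) ℂ) (hw : w ≠ 0)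
    (q : MvPolynomial (Fin N ⊕ Unit) ℂ) (hq : q = p + s * w) :
    (p.totalDegree : ℤ) ≤ d * q.totalDegree - d * k + d := by
  set E : MvPolynomial (Fin N ⊕ Unit) ℂ ≃ₐ[ℂ] Polynomial (MvPolynomial (Fin N) ℂ) :=
    (renameEquiv ℂ (Equiv.optionEquivSumPUnit (Fin N)).symm).trans (optionEquivLeft ℂ (Fin N))
    with hE
  have hdegE (f : MvPolynomial (Fin N ⊕ Unit) ℂ) :
      ((optionEquivLeft ℂ (Fin N)).symm (E f)).totalDegree = f.totalDegree := by
    rw [hE, AlgEquiv.trans_apply, AlgEquiv.symm_apply_apply, totalDegree_renameEquiv]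
  have hEX : E (X (Sum.inr ())) = Polynomial.X := by
    simp [hE]
  have hEC (a : MvPolynomial (Fin N) ℂ) : E (rename Sum.inl a) = Polynomial.C a := by
    rw [hE, AlgEquiv.trans_apply, ← AlgEquiv.eq_symm_apply, optionEquivLeft_symm_C_eq_rename,
      renameEquiv_apply, rename_rename]
    rfl
  have hEsum (c : Fin k → MvPolynomial (Fin N) ℂ) :
      E (∑ j : Fin k, rename Sum.inl (c j) * X (Sum.inr ()) ^ (j : ℕ)) =
        ∑ j : Fin k, Polynomial.C (c j) * Polynomial.X ^ (j : ℕ) := by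
    simp only [map_sum, map_mul, map_pow, hEX, hEC]
  have hEs : E s = Polynomial.X ^ k + ∑ j : Fin k, Polynomial.C (ς j) * Polynomial.X ^ (j : ℕ) := by
    rw [hs, map_add, map_pow, hEX, hEsum]
  have hmonic : (E s).Monic := hEs ▸ Polynomial.monic_X_pow_add (degree_sum_C_mul_X_pow_lt ς)
  have hnat : (E s).natDegree = k := by
    rw [hEs]
    exact Polynomial.natDegree_eq_of_degree_eq_some
      ((Polynomial.degree_add_eq_left_of_degree_lt (by
        simpa using degree_sum_C_mul_X_pow_lt ς)).trans (Polynomial.degree_X_pow k))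
  have hP : (E p).degree < ((E s).natDegree : WithBot ℕ) := by
    rw [hnat, hp, hEsum]
    exact degree_sum_C_mul_X_pow_lt pc
  obtain ⟨hkq, hle⟩ := totalDegree_optionEquivLeft_symm_remainder_le hmonic hP
    (show E w ≠ 0 from E.map_ne_zero_iff.2 hw)
  rw [← map_mul, ← map_add, ← hq, hdegE, hnat] at hkq hle
  rw [hdegE, hdegE, ← hd] at hle
  obtain ⟨a, ha⟩ := Nat.exists_eq_add_of_le hkq
  obtain ⟨b, hb⟩ := Nat.exists_eq_add_of_le hdk
  rw [ha, hb, Nat.add_sub_cancel_left, Nat.add_sub_cancel_left] at hle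
  rw [ha, hb]
  have hka : a ≤ k * a := Nat.le_mul_of_pos_left a hk
  zify at hle hka
  push_cast
  linarith
end

section
/- Let w ∈ ℂ[z,y] with w not identically zero and set q = p + s·w. If d = k then deg p ≤ deg q. -/
open MvPolynomial

namespace MvPolynomial

variable {σ R : Type*} [CommSemiring R]

theorem homogeneousComponent_add_mul_of_totalDegree_le {f g : MvPolynomial σ R} {m n : ℕ}
    (hf : f.totalDegree ≤ m) (hg : g.totalDegree ≤ n) :
    homogeneousComponent (m + n) (f * g) =
      homogeneousComponent m f * homogeneousComponent n g := by
  classical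
  ext e
  rw [coeff_homogeneousComponent, coeff_mul, coeff_mul]
  have hdeg : ∀ x ∈ Finset.HasAntidiagonal.antidiagonal e, x.1.degree + x.2.degree = e.degree := by
    intro x hx
    rw [← Finset.HasAntidiagonal.mem_antidiagonal.mp hx, map_add]
  split_ifs with he
  · refine Finset.sum_congr rfl fun x hx => ?_
    have hx' := hdeg x hx
    rw [coeff_homogeneousComponent, coeff_homogeneousComponent]
    rcases lt_trichotomy x.1.degree m with h | h | h
    · have : coeff x.2 g = 0 := coeff_eq_zero_of_totalDegree_lt (by
        change g.totalDegree < x.2.degree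
        omega)
      simp [this]
    · rw [if_pos h, if_pos (by omega)]
    · have : coeff x.1 f = 0 := coeff_eq_zero_of_totalDegree_lt (by
        change f.totalDegree < x.1.degree
        omega)
      simp [this]
  · refine (Finset.sum_eq_zero fun x hx => ?_).symm
    have hx' := hdeg x hx
    rw [coeff_homogeneousComponent, coeff_homogeneousComponent]
    split_ifs <;> first | omega | simp

theorem homogeneousComponent_totalDegree_ne_zero {f : MvPolynomial σ R} (hf : f ≠ 0) :
    homogeneousComponent f.totalDegree f ≠ 0 := by
  obtain ⟨e, he, hdeg⟩ := Finset.exists_mem_eq_sup f.support (support_nonempty.mpr hf)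
    fun e => e.degree
  change f.totalDegree = e.degree at hdeg
  intro h
  have hc := congrArg (coeff e) h
  rw [coeff_homogeneousComponent, if_pos hdeg.symm] at hc
  exact mem_support_iff.mp he hc

theorem degreeOf_homogeneousComponent_le (i : σ) (n : ℕ) (f : MvPolynomial σ R) :
    (homogeneousComponent n f).degreeOf i ≤ f.degreeOf i := by
  rw [degreeOf_le_iff]
  intro e he
  rw [support_homogeneousComponent] at he
  exact monomial_le_degreeOf i (Finset.mem_filter.mp he).1

theorem degreeOf_sum_rename_inl_mul_X_pow_lt {τ : Type*} {k : ℕ} (hk : 0 < k) (i : τ)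
    (c : Fin k → MvPolynomial σ R) :
    (∑ j : Fin k, rename Sum.inl (c j) * X (Sum.inr i) ^ (j : ℕ) :
      MvPolynomial (σ ⊕ τ) R).degreeOf (Sum.inr i) < k := by
  classical
  refine (degreeOf_sum_le _ _ _).trans_lt ((Finset.sup_lt_iff hk).mpr fun j _ => ?_)
  refine (degreeOf_mul_le _ _ _).trans_lt ?_
  have h1 : (rename Sum.inl (c j) : MvPolynomial (σ ⊕ τ) R).degreeOf (Sum.inr i) = 0 := by
    rw [← Nat.le_zero, degreeOf_le_iff]
    intro e he
    obtain ⟨u, rfl, -⟩ := coeff_rename_ne_zero _ _ _ (mem_support_iff.mp he)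
    exact (Finsupp.mapDomain_of_notMem_range _ _ (by simp)).le
  have h2 : (X (Sum.inr i) ^ (j : ℕ) : MvPolynomial (σ ⊕ τ) R).degreeOf (Sum.inr i) ≤ j := by
    rw [X_pow_eq_monomial, degreeOf_le_iff]
    intro e he
    rw [Finset.mem_singleton.mp (support_monomial_subset he)]
    simp
  omega

end MvPolynomial

/-- With `s(z,y) = y^k + ∑_{j<k} ς_j(z) y^j` of total degree `d ≥ k`,
`p(z,y) = ∑_{j<k} p_j(z) y^j`, `w ≢ 0` and `q = p + s·w`: if `d = k` then `deg p ≤ deg q`. -/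
theorem stmt1 (N : ℕ) (hN : 1 ≤ N) (k : ℕ) (hk : 1 ≤ k)
    (ς : Fin k → MvPolynomial (Fin N) ℂ)
    (s : MvPolynomial (Fin N ⊕ Unit) ℂ)
    (hs : s = X (Sum.inr ()) ^ k +
      ∑ j : Fin k, rename Sum.inl (ς j) * X (Sum.inr ()) ^ (j : ℕ))
    (d : ℕ) (hd : d = s.totalDegree) (hdk : k ≤ d)
    (pc : Fin k → MvPolynomial (Fin N) ℂ)
    (p : MvPolynomial (Fin N ⊕ Unit) ℂ)
    (hp : p = ∑ j : Fin k, rename Sum.inl (pc j) * X (Sum.inr ()) ^ (j : ℕ))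
    (w : MvPolynomial (Fin N ⊕ Unit) ℂ) (hw : w ≠ 0)
    (q : MvPolynomial (Fin N ⊕ Unit) ℂ) (hq : q = p + s * w)
    (hdek : d = k) :
    p.totalDegree ≤ q.totalDegree := by
  by_contra! hlt
  have hk0 : 0 < k := hk
  have hpdeg : p.degreeOf (Sum.inr ()) < k := by
    rw [hp]
    exact degreeOf_sum_rename_inl_mul_X_pow_lt hk0 () pc
  have hcoeff : coeff (Finsupp.single (Sum.inr ()) k) s = 1 := by
    rw [hs, coeff_add, coeff_X_pow, if_pos rfl]
    have : coeff (Finsupp.single (Sum.inr ()) k)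
        (∑ j : Fin k, rename Sum.inl (ς j) * X (Sum.inr ()) ^ (j : ℕ)) = 0 := by
      by_contra h
      have h1 := monomial_le_degreeOf (Sum.inr ()) (mem_support_iff.mpr h)
      have h2 := degreeOf_sum_rename_inl_mul_X_pow_lt hk0 () ς
      rw [Finsupp.single_eq_same] at h1
      omega
    rw [this, add_zero]
  have hsupp : Finsupp.single (Sum.inr ()) k ∈ (homogeneousComponent k s).support := by
    rw [mem_support_iff, coeff_homogeneousComponent, if_pos (by simp), hcoeff]
    exact one_ne_zero
  have hs_ne : homogeneousComponent k s ≠ 0 := by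
    rintro h
    simp [h] at hsupp
  have hw_ne := homogeneousComponent_totalDegree_ne_zero hw
  have hs0 : s ≠ 0 := by
    rintro rfl
    simp at hcoeff
  have hsw : (s * w).totalDegree = k + w.totalDegree := by
    rw [totalDegree_mul_of_isDomain hs0 hw]
    omega
  have hptot : p.totalDegree = k + w.totalDegree := by
    have hswp : s * w = q - p := by rw [hq]; ring
    have hpsw : p = q - s * w := by rw [hq]; ring
    have h1 := totalDegree_sub q p
    have h2 := totalDegree_sub q (s * w)
    rw [← hswp] at h1
    rw [← hpsw] at h2
    rcases le_max_iff.mp h2 with h | h <;> rcases le_max_iff.mp h1 with h' | h' <;> omega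
  have hq0 : homogeneousComponent (k + w.totalDegree) q = 0 :=
    homogeneousComponent_eq_zero _ _ (by omega)
  rw [hq, map_add, homogeneousComponent_add_mul_of_totalDegree_le (by omega) le_rfl] at hq0
  have hp_top := degreeOf_homogeneousComponent_le (Sum.inr ()) (k + w.totalDegree) p
  rw [eq_neg_of_add_eq_zero_left hq0, degreeOf_neg, degreeOf_mul_eq hs_ne hw_ne] at hp_top
  have hs_top := monomial_le_degreeOf (Sum.inr ()) hsupp
  rw [Finsupp.single_eq_same] at hs_top
  omega
end

section
/- The estimate deg p ≤ d·deg q − d·k + d is optimal: for all integers N ≥ 1, k ≥ 1 and d > k there exists a polynomial s(z,y) = y^k + Σ_{j=0}^{k−1} ς_j(z) y^j of total degree d such that, taking p = s − y^k and w = −1 (hence q = p + s·w = −y^k), one has deg q = k and deg p = d = d·deg q − d·k + d. -/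
open MvPolynomial

/-- Optimality of the estimate `deg p ≤ d·deg q − d·k + d`:
for all `N ≥ 1`, `k ≥ 1` and `d > k` there is `s(z,y) = y^k + ∑_{j<k} ς_j(z) y^j` of total
degree `d` such that, with `p = s − y^k` and `w = −1` (hence `q = p + s·w = −y^k`),
one has `deg q = k` and `deg p = d = d·deg q − d·k + d`. -/
theorem stmt2 (N k d : ℕ) (hN : 1 ≤ N) (hk : 1 ≤ k) (hkd : k < d) :
    ∃ ς : Fin k → MvPolynomial (Fin N) ℂ,
      ∀ s p q : MvPolynomial (Fin N ⊕ Unit) ℂ,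
        s = X (Sum.inr ()) ^ k +
          ∑ j : Fin k, rename Sum.inl (ς j) * X (Sum.inr ()) ^ (j : ℕ) →
        p = s - X (Sum.inr ()) ^ k →
        q = p + s * (-1) →
        s.totalDegree = d ∧ q.totalDegree = k ∧ p.totalDegree = d ∧
          (p.totalDegree : ℤ) = d * q.totalDegree - d * k + d := by
  have : NeZero N := ⟨by omega⟩
  have : NeZero k := ⟨by omega⟩
  refine ⟨Pi.single 0 (X 0 ^ d), ?_⟩
  rintro s p q hs rfl rfl
  have hsum : ∑ j : Fin k, rename (Sum.inl : Fin N → Fin N ⊕ Unit)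
      ((Pi.single 0 (X 0 ^ d) : Fin k → MvPolynomial (Fin N) ℂ) j) * X (Sum.inr ()) ^ (j : ℕ) =
      X (Sum.inl 0) ^ d := by
    rw [Finset.sum_eq_single 0]
    · simp
    · intro j _ hj
      simp [Pi.single_eq_of_ne hj]
    · simp
  rw [hsum] at hs
  have hp : s - X (Sum.inr ()) ^ k = X (Sum.inl 0) ^ d := by rw [hs]; ring
  have hq : s - X (Sum.inr ()) ^ k + s * (-1) = -X (Sum.inr ()) ^ k := by ring
  have hsd : s.totalDegree = d := by
    rw [hs, totalDegree_add_eq_right_of_totalDegree_lt, totalDegree_X_pow]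
    simpa only [totalDegree_X_pow] using hkd
  rw [hq, hp, totalDegree_neg, totalDegree_X_pow, totalDegree_X_pow]
  exact ⟨hsd, rfl, rfl, by ring⟩
end

section
/- Let w ∈ ℂ[z,y] be arbitrary and set q = p + s·w. Then deg p ≤ max{deg q, d·deg q − d·k + d} ≤ d·deg q. Moreover, if d = k then deg p ≤ deg q. -/
open MvPolynomial

/-- Evaluation of a univariate polynomial over `ℂ[z]` as a polynomial in `z` and one further
variable `y`. -/
noncomputable def evalLastVar (σ : Type*) :
    Polynomial (MvPolynomial σ ℂ) →+* MvPolynomial (σ ⊕ Unit) ℂ :=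
  Polynomial.eval₂RingHom (rename Sum.inl : MvPolynomial σ ℂ →ₐ[ℂ] _).toRingHom (X (Sum.inr ()))

section

variable {σ : Type*}

lemma evalLastVar_C (c : MvPolynomial σ ℂ) :
    evalLastVar σ (Polynomial.C c) = rename Sum.inl c := by
  simp [evalLastVar]

lemma evalLastVar_X : evalLastVar σ Polynomial.X = X (Sum.inr ()) := by
  simp [evalLastVar]

lemma evalLastVar_monomial (n : ℕ) (c : MvPolynomial σ ℂ) :
    evalLastVar σ (Polynomial.monomial n c) = rename Sum.inl c * X (Sum.inr ()) ^ n := by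
  simp [evalLastVar]

lemma evalLastVar_surjective : Function.Surjective (evalLastVar σ) := by
  intro f
  induction f using MvPolynomial.induction_on with
  | C a => exact ⟨Polynomial.C (C a), by rw [evalLastVar_C, rename_C]⟩
  | add f g hf hg =>
    obtain ⟨F, rfl⟩ := hf
    obtain ⟨G, rfl⟩ := hg
    exact ⟨F + G, map_add _ _ _⟩
  | mul_X f i hf =>
    obtain ⟨F, rfl⟩ := hf
    rcases i with i | ⟨⟩
    · exact ⟨F * Polynomial.C (X i), by rw [map_mul, evalLastVar_C, rename_X]⟩
    · exact ⟨F * Polynomial.X, by rw [map_mul, evalLastVar_X]⟩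

lemma coeff_evalLastVar (f : Polynomial (MvPolynomial σ ℂ)) (m : σ →₀ ℕ) (i : ℕ) :
    coeff (m.mapDomain Sum.inl + Finsupp.single (Sum.inr ()) i) (evalLastVar σ f) =
      coeff m (f.coeff i) := by
  classical
  induction f using Polynomial.induction_on' with
  | add f g hf hg => simp [hf, hg]
  | monomial n c =>
    rw [evalLastVar_monomial, Polynomial.coeff_monomial]
    have hy (u : σ →₀ ℕ) : u.mapDomain Sum.inl (Sum.inr () : σ ⊕ Unit) = 0 :=
      Finsupp.mapDomain_of_notMem_range _ _ (by simp)
    split_ifs with h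
    · subst h
      rw [X_pow_eq_monomial, coeff_mul_monomial, mul_one,
        coeff_rename_mapDomain _ Sum.inl_injective]
    · rw [X_pow_eq_monomial, coeff_mul_monomial', coeff_zero]
      split_ifs with hle
      · rw [mul_one]
        refine coeff_rename_eq_zero _ _ _ fun u hu => ?_
        have h1 := DFunLike.congr_fun hu (Sum.inr ())
        have h2 := hle (Sum.inr ())
        simp [hy] at h1 h2
        omega
      · rfl

lemma totalDegree_coeff_add_le (f : Polynomial (MvPolynomial σ ℂ)) (i : ℕ) (h : f.coeff i ≠ 0) :
    (f.coeff i).totalDegree + i ≤ (evalLastVar σ f).totalDegree := by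
  obtain ⟨m, hm, hdeg⟩ := Finset.exists_mem_eq_sup (f.coeff i).support
    (support_nonempty.mpr h) (fun m => m.sum fun _ e => e)
  have hmem : m.mapDomain Sum.inl + Finsupp.single (Sum.inr ()) i ∈
      (evalLastVar σ f).support := by
    rw [mem_support_iff, coeff_evalLastVar]
    exact mem_support_iff.mp hm
  have hle := le_totalDegree hmem
  rw [Finsupp.sum_add_index' (by simp) (by simp),
    Finsupp.sum_mapDomain_index (by simp) (by simp), Finsupp.sum_single_index rfl] at hle
  rw [totalDegree, hdeg]
  exact hle

/-- The top coefficient of `P + S * W`, for `S` monic of degree `k` and `deg P < k`. -/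
lemma coeff_add_monic_mul {R : Type*} [CommRing R] {S P W : Polynomial R} {k n : ℕ}
    (hS : S.Monic) (hSk : S.natDegree = k) (hP : P.degree < k) (hW : W.natDegree ≤ n) :
    (P + S * W).coeff (n + k) = W.coeff n := by
  rw [Polynomial.coeff_add,
    Polynomial.coeff_eq_zero_of_degree_lt (hP.trans_le (by exact_mod_cast Nat.le_add_left k n)), zero_add,
    add_comm n k,
    Polynomial.coeff_mul_add_eq_of_natDegree_le hSk.le hW, ← hSk, hS.coeff_natDegree,
    one_mul]

lemma totalDegree_le_add_mul {S P : Polynomial (MvPolynomial σ ℂ)} {k : ℕ}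
    (hS : S.Monic) (hSk : S.natDegree = k) (hP : P.degree < k)
    (hk : k ≤ (evalLastVar σ S).totalDegree) (n : ℕ) :
    ∀ W : Polynomial (MvPolynomial σ ℂ), W.degree < n →
      (evalLastVar σ P).totalDegree ≤ (evalLastVar σ (P + S * W)).totalDegree +
        n * ((evalLastVar σ S).totalDegree - k) := by
  induction n with
  | zero =>
    intro W hW
    have : W = 0 := by simpa using hW
    simp [this]
  | succ n ih =>
    intro W hW
    have hWn : W.natDegree ≤ n :=
      Polynomial.natDegree_le_iff_degree_le.mpr (Order.lt_succ_iff.mp (by exact_mod_cast hW))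
    set d := (evalLastVar σ S).totalDegree
    set D := (evalLastVar σ (P + S * W)).totalDegree with hD
    have hdeg : (W - Polynomial.monomial n (W.coeff n)).degree < n := by
      rw [Polynomial.degree_lt_iff_coeff_zero]
      intro m hm
      rw [Polynomial.coeff_sub, Polynomial.coeff_monomial]
      split_ifs with h
      · rw [h, sub_self]
      · rw [Polynomial.coeff_eq_zero_of_natDegree_lt (by omega), sub_zero]
    have hstep : (evalLastVar σ
        (P + S * (W - Polynomial.monomial n (W.coeff n)))).totalDegree ≤ D + (d - k) := by
      by_cases hc : W.coeff n = 0
      · rw [hc, Polynomial.monomial_zero_right, sub_zero, ← hD]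
        exact Nat.le_add_right _ _
      have htop := coeff_add_monic_mul hS hSk hP hWn
      have hcD := totalDegree_coeff_add_le (P + S * W) (n + k) (by rwa [htop])
      rw [htop, ← hD] at hcD
      have heq : P + S * (W - Polynomial.monomial n (W.coeff n)) =
          (P + S * W) - S * Polynomial.monomial n (W.coeff n) := by ring
      rw [heq, map_sub, map_mul, evalLastVar_monomial]
      refine (totalDegree_sub _ _).trans (max_le (by omega) ?_)
      have h1 := totalDegree_mul (evalLastVar σ S)
        (rename Sum.inl (W.coeff n) * X (Sum.inr ()) ^ n)
      have h2 := totalDegree_mul (rename Sum.inl (W.coeff n) : MvPolynomial (σ ⊕ Unit) ℂ)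
        (X (Sum.inr ()) ^ n)
      have h3 := totalDegree_rename_le (Sum.inl : σ → σ ⊕ Unit) (W.coeff n)
      rw [totalDegree_X_pow] at h2
      omega
    have := ih _ hdeg
    rw [Nat.succ_mul]
    omega

end

/-- With `s(z,y) = y^k + ∑_{j<k} ς_j(z) y^j` of total degree `d ≥ k`,
`p(z,y) = ∑_{j<k} p_j(z) y^j`, `w` arbitrary and `q = p + s·w`:
`deg p ≤ max{deg q, d·deg q − d·k + d} ≤ d·deg q`; moreover, if `d = k` then
`deg p ≤ deg q`. -/
theorem stmt3 (N : ℕ) (hN : 1 ≤ N) (k : ℕ) (hk : 1 ≤ k)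
    (ς : Fin k → MvPolynomial (Fin N) ℂ)
    (s : MvPolynomial (Fin N ⊕ Unit) ℂ)
    (hs : s = X (Sum.inr ()) ^ k +
      ∑ j : Fin k, rename Sum.inl (ς j) * X (Sum.inr ()) ^ (j : ℕ))
    (d : ℕ) (hd : d = s.totalDegree) (hdk : k ≤ d)
    (pc : Fin k → MvPolynomial (Fin N) ℂ)
    (p : MvPolynomial (Fin N ⊕ Unit) ℂ)
    (hp : p = ∑ j : Fin k, rename Sum.inl (pc j) * X (Sum.inr ()) ^ (j : ℕ))
    (w : MvPolynomial (Fin N ⊕ Unit) ℂ)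
    (q : MvPolynomial (Fin N ⊕ Unit) ℂ) (hq : q = p + s * w) :
    (p.totalDegree : ℤ) ≤
        max (q.totalDegree : ℤ) ((d : ℤ) * q.totalDegree - d * k + d) ∧
      max (q.totalDegree : ℤ) ((d : ℤ) * q.totalDegree - d * k + d) ≤
        (d : ℤ) * q.totalDegree ∧
      (d = k → p.totalDegree ≤ q.totalDegree) := by
  classical
  obtain ⟨W, rfl⟩ := evalLastVar_surjective w
  have hsum (c : Fin k → MvPolynomial (Fin N) ℂ) :
      evalLastVar _ (∑ j : Fin k, Polynomial.monomial (j : ℕ) (c j)) =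
        ∑ j : Fin k, rename Sum.inl (c j) * X (Sum.inr ()) ^ (j : ℕ) := by
    simp only [map_sum, evalLastVar_monomial]
  have hlt (c : Fin k → MvPolynomial (Fin N) ℂ) :
      (∑ j : Fin k, Polynomial.monomial (j : ℕ) (c j)).degree < k := by
    refine (Polynomial.degree_sum_le _ _).trans_lt
      ((Finset.sup_lt_iff (WithBot.bot_lt_coe k)).mpr fun j _ => ?_)
    exact (Polynomial.degree_monomial_le _ _).trans_lt (WithBot.coe_lt_coe.mpr j.2)
  set P := ∑ j : Fin k, Polynomial.monomial (j : ℕ) (pc j) with hPdef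
  set S := Polynomial.X ^ k + ∑ j : Fin k, Polynomial.monomial (j : ℕ) (ς j) with hSdef
  have hpP : p = evalLastVar _ P := by rw [hp, hPdef, hsum]
  have hsS : s = evalLastVar _ S := by
    rw [hs, hSdef, map_add, map_pow, evalLastVar_X, hsum]
  have hS : S.Monic := Polynomial.monic_X_pow_add (hlt ς)
  have hSk : S.natDegree = k := Polynomial.natDegree_eq_of_degree_eq_some (by
    rw [hSdef, Polynomial.degree_add_eq_left_of_degree_lt] <;> simp [hlt ς])
  have hqQ : q = evalLastVar _ (P + S * W) := by
    rw [hq, hpP, hsS, map_add (evalLastVar _) P, map_mul]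
  have hk' : (1 : ℤ) ≤ k := by exact_mod_cast hk
  have hdk' : (k : ℤ) ≤ d := by exact_mod_cast hdk
  have hmax : max (q.totalDegree : ℤ) ((d : ℤ) * q.totalDegree - d * k + d) ≤
      (d : ℤ) * q.totalDegree := by
    refine max_le ?_ ?_ <;> nlinarith
  by_cases hW : W = 0
  · have hpq : p = q := by rw [hq, hW, map_zero, mul_zero, add_zero]
    exact ⟨hpq ▸ le_max_left _ _, hmax, fun _ => by rw [hpq]⟩
  have hbound := totalDegree_le_add_mul hS hSk (hlt pc) (by rwa [← hsS, ← hd]) (W.natDegree + 1) W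
    (Polynomial.degree_le_natDegree.trans_lt (by exact_mod_cast Nat.lt_succ_self _))
  have htop := coeff_add_monic_mul hS hSk (hlt pc) (le_refl W.natDegree)
  have hn := totalDegree_coeff_add_le (P + S * W) (W.natDegree + k) (by
    rw [htop]; exact Polynomial.leadingCoeff_ne_zero.mpr hW)
  rw [← hqQ] at hn
  rw [← hPdef, ← hpP, ← hqQ, ← hsS, ← hd] at hbound
  refine ⟨le_max_of_le_right ?_, hmax, fun h => by simpa [h] using hbound⟩
  have hnD : (W.natDegree : ℤ) + k ≤ q.totalDegree := by omega
  zify [hdk] at hbound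
  nlinarith [mul_nonneg (sub_nonneg.mpr hnD) (sub_nonneg.mpr hdk'),
    mul_nonneg (sub_nonneg.mpr hk') (show (0 : ℤ) ≤ q.totalDegree - k by omega)]
end

section
/- Let ς_0 ∈ ℂ[z_1,…,z_N] be not identically zero, k ≥ 1, V = {(z,y) ∈ ℂ^N × ℂ : y^k + ς_0(z) = 0} and d = deg(y^k + ς_0(z)) = max{k, deg ς_0}. Then for every polynomial p of the form p(z,y) = Σ_{j=0}^{k−1} p_j(z) y^j one has deg_V p ≤ deg p and k·deg p ≤ d·deg_V p (equivalently, deg p ≤ max{1, (deg ς_0)/k}·deg_V p). -/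
open MvPolynomial

/-- The degree of a polynomial relative to an algebraic set `V`:
the minimal total degree of a polynomial agreeing with `p` at every point of `V`. -/
noncomputable def degV {σ : Type*} (V : Set (σ → ℂ)) (p : MvPolynomial σ ℂ) : ℕ :=
  sInf {m : ℕ | ∃ q : MvPolynomial σ ℂ,
    (∀ x ∈ V, eval x q = eval x p) ∧ q.totalDegree = m}

open Polynomial in
theorem Polynomial.eq_zero_of_eval_eq_zero_of_pow_eq {k : ℕ} {g : ℂ[X]} (hk : g.natDegree < k)
    {a : ℂ} (ha : a ≠ 0) (hg : ∀ y, y ^ k = a → g.eval y = 0) : g = 0 := by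
  classical
  have hk0 : k ≠ 0 := by omega
  have hζ := Complex.isPrimitiveRoot_exp k hk0
  obtain ⟨α, hα⟩ := IsAlgClosed.exists_pow_nat_eq a (Nat.pos_of_ne_zero hk0)
  refine Polynomial.eq_zero_of_natDegree_lt_card_of_eval_eq_zero' g (nthRoots k a).toFinset
    (fun y hy => hg y ?_) ?_
  · exact (mem_nthRoots (Nat.pos_of_ne_zero hk0)).1 (Multiset.mem_toFinset.1 hy)
  · rw [Multiset.toFinset_card_of_nodup (hζ.nthRoots_nodup ha), hζ.card_nthRoots,
      if_pos ⟨α, hα⟩]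
    exact hk

namespace MvPolynomial

theorem degreeOf_inr_rename_inl {R σ τ : Type*} [CommSemiring R] (q : MvPolynomial σ R) (t : τ) :
    degreeOf (Sum.inr t) (rename (Sum.inl : σ → σ ⊕ τ) q) = 0 := by
  classical
  by_contra h
  have hmem : Sum.inr t ∈ (rename (Sum.inl : σ → σ ⊕ τ) q).vars := by
    rw [vars_def, Multiset.mem_toFinset, ← Multiset.count_pos, ← degreeOf_def]
    omega
  simpa using vars_rename _ _ hmem

theorem degreeOf_inr_rename_inl_mul_X_pow_le {R σ τ : Type*} [CommSemiring R] [Nontrivial R]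
    (q : MvPolynomial σ R) (t : τ) (e : ℕ) :
    degreeOf (Sum.inr t) (rename (Sum.inl : σ → σ ⊕ τ) q * X (Sum.inr t) ^ e) ≤ e := by
  refine (degreeOf_mul_le _ _ _).trans ?_
  rw [degreeOf_inr_rename_inl, degreeOf_X_self_pow, zero_add]

theorem natDegree_aeval_elim_C_X_le {R σ : Type*} [CommSemiring R] [Fintype σ]
    (f : MvPolynomial (σ ⊕ Unit) R) (z : σ → R) :
    (aeval (Sum.elim (fun i => Polynomial.C (z i)) fun _ => Polynomial.X) f).natDegree ≤
      degreeOf (Sum.inr ()) f := by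
  rw [aeval_def, eval₂_eq']
  refine Polynomial.natDegree_sum_le_of_forall_le _ _ fun m hm => ?_
  refine le_trans ?_ (monomial_le_degreeOf (Sum.inr ()) hm)
  simp only [Fintype.prod_sum_type, Sum.elim_inl, Sum.elim_inr, Finset.univ_unique,
    Finset.prod_singleton, ← Polynomial.C_pow, ← map_prod, Polynomial.algebraMap_eq, ← mul_assoc,
    ← map_mul]
  exact Polynomial.natDegree_C_mul_X_pow_le _ _

theorem eval_aeval_elim_C_X {R σ : Type*} [CommSemiring R]
    (f : MvPolynomial (σ ⊕ Unit) R) (z : σ → R) (y : R) :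
    (aeval (Sum.elim (fun i => Polynomial.C (z i)) fun _ => Polynomial.X) f).eval y =
      eval (Sum.elim z fun _ => y) f := by
  induction f using MvPolynomial.induction_on with
  | C a => simp
  | add p q hp hq => simp [hp, hq]
  | mul_X p i hp => rcases i with i | i <;> simp [hp]

theorem eq_zero_of_degreeOf_lt_of_eval_eq_zero {σ : Type*} [Fintype σ] {k : ℕ}
    {ς₀ : MvPolynomial σ ℂ} (hς₀ : ς₀ ≠ 0) {f : MvPolynomial (σ ⊕ Unit) ℂ}
    (hf : degreeOf (Sum.inr ()) f < k)
    (hV : ∀ x, eval x (X (Sum.inr ()) ^ k + rename Sum.inl ς₀) = 0 → eval x f = 0) : f = 0 := by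
  have h : f * rename Sum.inl ς₀ = 0 := by
    refine MvPolynomial.funext fun x => ?_
    rw [map_mul, map_zero, eval_rename]
    by_cases hz : eval (x ∘ Sum.inl) ς₀ = 0
    · rw [hz, mul_zero]
    have hg := Polynomial.eq_zero_of_eval_eq_zero_of_pow_eq
      ((natDegree_aeval_elim_C_X_le f (x ∘ Sum.inl)).trans_lt hf) (neg_ne_zero.2 hz) fun y hy => by
        rw [eval_aeval_elim_C_X]
        exact hV _ (by simp [eval_rename, hy])
    have hx := eval_aeval_elim_C_X f (x ∘ Sum.inl) (x (Sum.inr ()))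
    rw [hg, Polynomial.eval_zero] at hx
    have hxe : Sum.elim (x ∘ Sum.inl) (fun _ => x (Sum.inr ())) = x := by
      ext (i | i) <;> rfl
    rw [hxe] at hx
    rw [← hx, zero_mul]
  exact (mul_eq_zero.1 h).resolve_right fun h0 =>
    hς₀ (rename_injective _ Sum.inl_injective (by rw [h0, map_zero]))

/-- Replacing `y ^ k` by `-ς₀` turns `q` into a polynomial of degree `< k` in `y`. -/
theorem exists_degreeOf_lt_eval_eq {σ : Type*} [Fintype σ] {k : ℕ} (hk : 1 ≤ k)
    (ς₀ : MvPolynomial σ ℂ) (q : MvPolynomial (σ ⊕ Unit) ℂ) :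
    ∃ r : MvPolynomial (σ ⊕ Unit) ℂ, degreeOf (Sum.inr ()) r < k ∧
      (∀ x, eval x (X (Sum.inr ()) ^ k + rename Sum.inl ς₀) = 0 → eval x r = eval x q) ∧
      k * r.totalDegree ≤ max k ς₀.totalDegree * q.totalDegree := by
  let P : (σ ⊕ Unit →₀ ℕ) → MvPolynomial σ ℂ := fun m =>
    C (coeff m q) * (∏ i, X i ^ m (Sum.inl i)) * (-ς₀) ^ (m (Sum.inr ()) / k)
  refine ⟨∑ m ∈ q.support, rename Sum.inl (P m) * X (Sum.inr ()) ^ (m (Sum.inr ()) % k),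
    ?_, ?_, ?_⟩
  · refine (degreeOf_sum_le _ _ _).trans_lt ((Finset.sup_lt_iff (Nat.bot_eq_zero ▸ hk)).2 ?_)
    exact fun m _ => (degreeOf_inr_rename_inl_mul_X_pow_le _ _ _).trans_lt (Nat.mod_lt _ hk)
  · intro x hx
    have hx' : -eval (x ∘ Sum.inl) ς₀ = x (Sum.inr ()) ^ k := by
      rw [map_add, map_pow, eval_X, eval_rename] at hx
      linear_combination -hx
    rw [eval_eq' x q, map_sum]
    refine Finset.sum_congr rfl fun m _ => ?_
    simp only [P, map_mul, map_pow, map_prod, eval_rename, eval_X, map_neg, eval_C, hx',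
      rename_C, rename_X, Fintype.prod_sum_type, Finset.univ_unique, Finset.prod_singleton]
    rw [mul_assoc, ← pow_mul, ← pow_add, Nat.div_add_mod, mul_assoc]
  · rw [mul_comm, ← Nat.le_div_iff_mul_le hk]
    refine (totalDegree_finsetSum _ _).trans (Finset.sup_le fun m hm => ?_)
    rw [Nat.le_div_iff_mul_le hk, mul_comm]
    have hm' : ∑ i, m (Sum.inl i) + m (Sum.inr ()) ≤ q.totalDegree := by
      have := le_totalDegree hm
      rwa [Finsupp.sum_fintype _ _ (fun _ => rfl), Fintype.sum_sum_type,
        Fintype.sum_unique (fun a => m (Sum.inr a))] at this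
    have hprod : (∏ i, (X i : MvPolynomial σ ℂ) ^ m (Sum.inl i)).totalDegree ≤
        ∑ i, m (Sum.inl i) :=
      (totalDegree_finsetProd _ _).trans (Finset.sum_le_sum fun i _ => (totalDegree_X_pow i _).le)
    have hpow : ((-ς₀) ^ (m (Sum.inr ()) / k)).totalDegree ≤
        m (Sum.inr ()) / k * ς₀.totalDegree := by
      simpa using totalDegree_pow (-ς₀) (m (Sum.inr ()) / k)
    have hP : (P m).totalDegree ≤
        ∑ i, m (Sum.inl i) + m (Sum.inr ()) / k * ς₀.totalDegree := by
      refine (totalDegree_mul _ _).trans (add_le_add ((totalDegree_mul _ _).trans ?_) hpow)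
      rwa [totalDegree_C, zero_add]
    have hdeg : (rename Sum.inl (P m) *
        (X (Sum.inr ()) : MvPolynomial (σ ⊕ Unit) ℂ) ^ (m (Sum.inr ()) % k)).totalDegree ≤
        ∑ i, m (Sum.inl i) + m (Sum.inr ()) / k * ς₀.totalDegree + m (Sum.inr ()) % k :=
      (totalDegree_mul _ _).trans
        (add_le_add ((totalDegree_rename_le _ _).trans hP) (totalDegree_X_pow _ _).le)
    set D := max k ς₀.totalDegree
    have hkD : k ≤ D := le_max_left _ _
    have hςD : ς₀.totalDegree ≤ D := le_max_right _ _
    calc _ ≤ k * (∑ i, m (Sum.inl i) + m (Sum.inr ()) / k * ς₀.totalDegree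
            + m (Sum.inr ()) % k) := Nat.mul_le_mul_left _ hdeg
      _ = k * ∑ i, m (Sum.inl i) + k * (m (Sum.inr ()) / k) * ς₀.totalDegree
            + k * (m (Sum.inr ()) % k) := by ring
      _ ≤ D * ∑ i, m (Sum.inl i) + k * (m (Sum.inr ()) / k) * D
            + D * (m (Sum.inr ()) % k) := by gcongr
      _ = D * (∑ i, m (Sum.inl i) + (k * (m (Sum.inr ()) / k) + m (Sum.inr ()) % k)) := by ring
      _ ≤ D * q.totalDegree := by rw [Nat.div_add_mod]; gcongr

end MvPolynomial

/-- For `V = {y^k + ς₀(z) = 0}` with `ς₀ ≢ 0` and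
`d = deg (y^k + ς₀(z)) = max{k, deg ς₀}`, every `p(z,y) = ∑_{j<k} p_j(z) y^j` satisfies
`deg_V p ≤ deg p` and `k·deg p ≤ d·deg_V p`. -/
theorem stmt5 (N : ℕ) (hN : 1 ≤ N) (k : ℕ) (hk : 1 ≤ k)
    (ς₀ : MvPolynomial (Fin N) ℂ) (hς₀ : ς₀ ≠ 0)
    (s : MvPolynomial (Fin N ⊕ Unit) ℂ)
    (hs : s = X (Sum.inr ()) ^ k + rename Sum.inl ς₀)
    (d : ℕ) (hd : d = s.totalDegree) (hd' : d = max k ς₀.totalDegree)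
    (V : Set ((Fin N ⊕ Unit) → ℂ)) (hV : V = {x | eval x s = 0})
    (pc : Fin k → MvPolynomial (Fin N) ℂ)
    (p : MvPolynomial (Fin N ⊕ Unit) ℂ)
    (hp : p = ∑ j : Fin k, rename Sum.inl (pc j) * X (Sum.inr ()) ^ (j : ℕ)) :
    degV V p ≤ p.totalDegree ∧ k * p.totalDegree ≤ d * degV V p := by
  have hmem := Nat.sInf_mem (s := {m : ℕ | ∃ q : MvPolynomial (Fin N ⊕ Unit) ℂ,
    (∀ x ∈ V, eval x q = eval x p) ∧ q.totalDegree = m}) ⟨_, p, fun _ _ => rfl, rfl⟩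
  refine ⟨Nat.sInf_le ⟨p, fun _ _ => rfl, rfl⟩, ?_⟩
  obtain ⟨q, hqV, hq : q.totalDegree = degV V p⟩ := hmem
  obtain ⟨r, hrk, hrV, hrd⟩ := exists_degreeOf_lt_eval_eq hk ς₀ q
  have hpk : degreeOf (Sum.inr ()) p < k := by
    rw [hp]
    refine (degreeOf_sum_le _ _ _).trans_lt ((Finset.sup_lt_iff (Nat.bot_eq_zero ▸ hk)).2 ?_)
    exact fun j _ => (degreeOf_inr_rename_inl_mul_X_pow_le _ _ _).trans_lt j.2
  have hpr : p - r = 0 := by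
    refine eq_zero_of_degreeOf_lt_of_eval_eq_zero hς₀
      ((degreeOf_sub_le _ _ _).trans_lt (max_lt hpk hrk)) fun x hx => ?_
    rw [map_sub, hrV x hx, hqV x (by rw [hV, hs]; exact hx), sub_self]
  rw [hd', ← hq, sub_eq_zero.1 hpr]
  exact hrd
end
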